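/- Let m ≥ 3 and let A, B ∈ F_2^m be such that supp(A) ∩ supp(B) = ∅ and 0 < |B| < |A|. Let D = (Δ_A ∪ Δ_B) \ {0}. Then the binary linear code C_D is self-orthogonal if and only if |B| ≥ 3. -/

import Mathlib

open Finset

def supp {m : ℕ} (v : Fin m → ZMod 2) : Finset (Fin m) :=
  Finset.univ.filter fun i => v i ≠ 0

def wt {m : ℕ} (v : Fin m → ZMod 2) : ℕ := (supp v).card

def delta {m : ℕ} (A : Fin m → ZMod 2) : Finset (Fin m → ZMod 2) :=
  Finset.univ.filter fun v => supp v ⊆ supp A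

def deltaT {m : ℕ} (T : Finset (Fin m)) : Finset (Fin m → ZMod 2) :=
  Finset.univ.filter fun v => supp v ⊆ T

def hwt {ι : Type*} [Fintype ι] (c : ι → ZMod 2) : ℕ :=
  (Finset.univ.filter fun i => c i ≠ 0).card

def cw {m : ℕ} (D : Finset (Fin m → ZMod 2)) (u : Fin m → ZMod 2) : ↥D → ZMod 2 :=
  fun g => ∑ i, u i * (g : Fin m → ZMod 2) i

def codeC {m : ℕ} (D : Finset (Fin m → ZMod 2)) :
    Submodule (ZMod 2) (↥D → ZMod 2) :=
  LinearMap.range (Matrix.mulVecLin (Matrix.of fun (g : ↥D) (i : Fin m) => (g : Fin m → ZMod 2) i))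

def dualCode {ι : Type*} [Fintype ι] (C : Submodule (ZMod 2) (ι → ZMod 2)) :
    Submodule (ZMod 2) (ι → ZMod 2) where
  carrier := {w | ∀ c ∈ C, ∑ i, w i * c i = 0}
  zero_mem' := by simp
  add_mem' := by
    intro a b ha hb c hc
    have h := congrArg₂ (· + ·) (ha c hc) (hb c hc)
    simpa [add_mul, Finset.sum_add_distrib] using h
  smul_mem' := by
    intro r w hw c hc
    have h := congrArg (r * ·) (hw c hc)
    simpa [Finset.mul_sum, mul_assoc] using h

def isMinDist {ι : Type*} [Fintype ι] (C : Set (ι → ZMod 2)) (d : ℕ) : Prop :=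
  (∃ c ∈ C, c ≠ 0 ∧ hwt c = d) ∧ ∀ c ∈ C, c ≠ 0 → d ≤ hwt c

def chi {m : ℕ} (u v : Fin m → ZMod 2) : ℤ :=
  if supp u ∩ supp v = ∅ then 1 else 0

theorem mem_supp {m : ℕ} (v : Fin m → ZMod 2) (i : Fin m) : i ∈ supp v ↔ v i ≠ 0 := by
  simp [supp]

theorem mem_delta {m : ℕ} (A v : Fin m → ZMod 2) : v ∈ delta A ↔ supp v ⊆ supp A := by
  simp [delta]

theorem zmod_two_eq_one_of_ne_zero {x : ZMod 2} (h : x ≠ 0) : x = 1 := by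
  revert x
  decide

theorem supp_injective {m : ℕ} : Function.Injective (supp : (Fin m → ZMod 2) → Finset (Fin m)) := by
  intro v w h
  funext i
  have hi : v i ≠ 0 ↔ w i ≠ 0 := by rw [← mem_supp, ← mem_supp, h]
  by_cases hv : v i = 0
  · have hw : w i = 0 := by simpa [hv] using hi
    rw [hv, hw]
  · rw [zmod_two_eq_one_of_ne_zero hv, zmod_two_eq_one_of_ne_zero (hi.mp hv)]

theorem codeC_le_dualCode_iff {m : ℕ} (D : Finset (Fin m → ZMod 2)) :
    codeC D ≤ dualCode (codeC D) ↔ ∀ i j : Fin m, ∑ g ∈ D, g i * g j = 0 := by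
  constructor
  · intro h i j
    have hcol : ∀ k : Fin m, (fun g : ↥D => (g : Fin m → ZMod 2) k) ∈ codeC D := by
      intro k
      refine ⟨Pi.single k 1, ?_⟩
      ext g
      simp
    have hij := h (hcol i) _ (hcol j)
    rwa [Finset.sum_coe_sort D (fun g => g i * g j)] at hij
  · rintro h _ ⟨u, rfl⟩ _ ⟨w, rfl⟩
    simp only [Matrix.mulVecLin_apply, Matrix.mulVec, dotProduct, Matrix.of_apply]
    rw [Finset.sum_coe_sort D (fun g => (∑ i, g i * u i) * ∑ j, g j * w j)]
    simp only [Finset.sum_mul_sum]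
    rw [Finset.sum_comm]
    refine Finset.sum_eq_zero fun i _ => ?_
    rw [Finset.sum_comm]
    refine Finset.sum_eq_zero fun j _ => ?_
    calc ∑ g ∈ D, g i * u i * (g j * w j) = (∑ g ∈ D, g i * g j) * (u i * w j) := by
          rw [Finset.sum_mul]
          exact Finset.sum_congr rfl fun g _ => by ring
      _ = 0 := by rw [h, zero_mul]

theorem sum_delta_mul_eq_zero {m : ℕ} (A : Fin m → ZMod 2) (hA : 3 ≤ wt A) (i j : Fin m) :
    ∑ g ∈ delta A, g i * g j = 0 := by
  obtain ⟨k, hkA, hk⟩ : ∃ k ∈ supp A, k ∉ ({i, j} : Finset (Fin m)) :=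
    Finset.exists_mem_notMem_of_card_lt_card (lt_of_le_of_lt Finset.card_le_two hA)
  simp only [Finset.mem_insert, Finset.mem_singleton, not_or] at hk
  have hik : i ≠ k := Ne.symm hk.1
  have hjk : j ≠ k := Ne.symm hk.2
  refine Finset.sum_involution (fun g _ => g + Pi.single k 1) ?_ ?_ ?_ ?_
  · intro g _
    simp [hik, hjk, CharTwo.add_self_eq_zero]
  · intro g _ _ h
    simpa using congrFun h k
  · intro g hg
    rw [mem_delta] at hg ⊢
    intro l hl
    by_cases hlk : l = k
    · rwa [hlk]
    · refine hg ?_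
      rw [mem_supp] at hl ⊢
      simpa [hlk] using hl
  · intro g _
    rw [add_assoc, ← Pi.single_add, CharTwo.add_self_eq_zero, Pi.single_zero, add_zero]

theorem delta_inter_delta {m : ℕ} {A B : Fin m → ZMod 2} (hdisj : supp A ∩ supp B = ∅) :
    delta A ∩ delta B = {0} := by
  ext v
  rw [Finset.mem_inter, mem_delta, mem_delta, ← Finset.subset_inter_iff, hdisj,
    Finset.subset_empty, Finset.mem_singleton]
  have h0 : supp (0 : Fin m → ZMod 2) = ∅ := by simp [supp]
  rw [← h0, supp_injective.eq_iff]

theorem stmt11 {m : ℕ} (hm : 3 ≤ m) (A B : Fin m → ZMod 2)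
    (hdisj : supp A ∩ supp B = ∅) (hB : 0 < wt B) (hBA : wt B < wt A)
    (D : Finset (Fin m → ZMod 2)) (hD : D = (delta A ∪ delta B) \ {0}) :
    codeC D ≤ dualCode (codeC D) ↔ 3 ≤ wt B := by
  subst hD
  rw [codeC_le_dualCode_iff]
  constructor
  · intro h
    by_contra! hlt
    obtain ⟨i, j, hij⟩ : ∃ i j, supp B = {i, j} := by
      have hcases : wt B = 1 ∨ wt B = 2 := by omega
      rcases hcases with h1 | h2
      · obtain ⟨i, hi⟩ := Finset.card_eq_one.mp h1
        exact ⟨i, i, by simpa using hi⟩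
      · obtain ⟨i, j, _, hij⟩ := Finset.card_eq_two.mp h2
        exact ⟨i, j, hij⟩
    have hi : B i ≠ 0 := (mem_supp B i).mp (by simp [hij])
    have hj : B j ≠ 0 := (mem_supp B j).mp (by simp [hij])
    have hsum := h i j
    rw [Finset.sum_eq_single B] at hsum
    · exact mul_ne_zero hi hj hsum
    · intro g hg hgB
      by_contra hne
      have hgi := (mem_supp g i).mpr (left_ne_zero_of_mul hne)
      have hgj := (mem_supp g j).mpr (right_ne_zero_of_mul hne)
      rcases Finset.mem_union.mp (Finset.mem_sdiff.mp hg).1 with hgA | hg'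
      · have hmem := Finset.mem_inter.mpr ⟨(mem_delta A g).mp hgA hgi, (mem_supp B i).mpr hi⟩
        simp [hdisj] at hmem
      · refine hgB (supp_injective (((mem_delta B g).mp hg').antisymm ?_))
        rw [hij]
        simp [Finset.insert_subset_iff, hgi, hgj]
    · intro hB'
      refine absurd ?_ hB'
      simp only [Finset.mem_sdiff, Finset.mem_union, mem_delta, Finset.mem_singleton]
      exact ⟨Or.inr subset_rfl, fun h0 => hi (by simp [h0])⟩
  · intro h3 i j
    have hunion := Finset.sum_union_inter (s₁ := delta A) (s₂ := delta B)
      (f := fun g => g i * g j)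
    rw [delta_inter_delta hdisj, sum_delta_mul_eq_zero A (by omega),
      sum_delta_mul_eq_zero B h3] at hunion
    rw [← Finset.erase_eq, Finset.sum_erase _ (by simp)]
    simpa using hunion
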